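/- (Theorem 2, bounded duality gap.) If the Frank–Wolfe algorithm is run for R ≥ 2 iterations, then there exists an iterate index r with 1 ≤ r ≤ R such that φ(w^(r)) ≤ (2·β·C_f/(R+2))·(1 + δ), where β = 27/8. -/

import Mathlib

open scoped RealInnerProductSpace BigOperators

noncomputable section

/-- The standard simplex `D = {w ∈ ℝ^K : wᵢ ≥ 0, Σᵢ wᵢ = 1}`. -/
def simplexD (K : ℕ) : Set (EuclideanSpace ℝ (Fin K)) :=
  {w | (∀ i, 0 ≤ w i) ∧ ∑ i, w i = 1}

/-- The surrogate duality gap `φ(w) = max_{s ∈ D} ⟨w − s, ∇L(w)⟩`. -/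
def dualGap {K : ℕ} (gradL : EuclideanSpace ℝ (Fin K) → EuclideanSpace ℝ (Fin K))
    (w : EuclideanSpace ℝ (Fin K)) : ℝ :=
  sSup ((fun s => ⟪w - s, gradL w⟫) '' simplexD K)

theorem fw_grad_ineq {K : ℕ} (L : EuclideanSpace ℝ (Fin K) → ℝ)
    (g x y : EuclideanSpace ℝ (Fin K)) (hg : HasGradientAt L g x)
    (hconv : ConvexOn ℝ Set.univ L) : L x - L y ≤ ⟪x - y, g⟫ := by
  have hc : ConvexOn ℝ Set.univ (L ∘ (AffineMap.lineMap x y : ℝ →ᵃ[ℝ] _)) := by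
    simpa using hconv.comp_affineMap (AffineMap.lineMap x y : ℝ →ᵃ[ℝ] _)
  have hd : HasDerivAt (L ∘ (AffineMap.lineMap x y : ℝ →ᵃ[ℝ] _)) ⟪g, y - x⟫ 0 := by
    have h1 : HasDerivAt (AffineMap.lineMap x y : ℝ → EuclideanSpace ℝ (Fin K)) (y - x) 0 :=
      AffineMap.hasDerivAt_lineMap
    have h2 : HasFDerivAt L (InnerProductSpace.toDual ℝ _ g)
        ((AffineMap.lineMap x y : ℝ → EuclideanSpace ℝ (Fin K)) 0) := by
      simpa using hg.hasFDerivAt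
    simpa using h2.comp_hasDerivAt (0:ℝ) h1
  have h := hc.le_slope_of_hasDerivAt (Set.mem_univ 0) (Set.mem_univ 1) zero_lt_one hd
  simp [slope_def_field] at h
  rw [real_inner_comm, ← neg_sub x y, inner_neg_left] at h
  linarith

theorem fw_bdd {K : ℕ} (g : EuclideanSpace ℝ (Fin K)) :
    BddBelow ((fun t => ⟪t, g⟫) '' simplexD K) := by
  refine ⟨-∑ i, |g i|, ?_⟩
  rintro _ ⟨t, ⟨h0, h1⟩, rfl⟩
  simp only [PiLp.inner_apply, RCLike.inner_apply, conj_trivial]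
  rw [← Finset.sum_neg_distrib]
  refine Finset.sum_le_sum fun i _ => ?_
  have hle : t i ≤ 1 := h1 ▸ Finset.single_le_sum (fun j _ => h0 j) (Finset.mem_univ i)
  have := h0 i
  have h2 := neg_abs_le (g i)
  have h3 := abs_nonneg (g i)
  nlinarith

theorem fw_mem {K : ℕ} (w s : EuclideanSpace ℝ (Fin K)) (hw : w ∈ simplexD K)
    (hs : s ∈ simplexD K) (γ : ℝ) (h0 : 0 ≤ γ) (h1 : γ ≤ 1) :
    w + γ • (s - w) ∈ simplexD K := by
  refine ⟨fun i => ?_, ?_⟩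
  · have a := hw.1 i
    have b := hs.1 i
    simp
    nlinarith
  · have a := hw.2
    have b := hs.2
    simp [Finset.sum_add_distrib, ← Finset.mul_sum, a, b]

/-- The scalar recursion argument. -/
theorem fw_scalar (h q : ℕ → ℝ) (A : ℝ) (hA : 0 ≤ A) (hh : ∀ r, 0 ≤ h r)
    (hq : ∀ r, h r ≤ q r)
    (hrec : ∀ r : ℕ, h (r+1) ≤ h r - 2 / ((r:ℝ)+2) * q r + (2 / ((r:ℝ)+2))^2 / 2 * A)
    (R : ℕ) (hR : 2 ≤ R) :
    ∃ r : ℕ, 1 ≤ r ∧ r ≤ R ∧ q r ≤ 27 / 4 * A / ((R:ℝ)+2) := by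
  by_contra! hcon
  have hprim : ∀ r : ℕ, h (r+1) ≤ 2 * A / (((r+1 : ℕ):ℝ) + 2) := by
    intro r
    induction r with
    | zero =>
      have h1 := hrec 0
      have h2 := hq 0
      norm_num at h1 ⊢
      linarith
    | succ r ih =>
      have h1 := hrec (r+1)
      have h2 := hq (r+1)
      push_cast at *
      set x : ℝ := (r:ℝ) + 1 with hx
      have hx0 : 0 < x := by positivity
      have h3 : h (r+1+1) ≤ (1 - 2/(x+2)) * (2*A/(x+2)) + (2/(x+2))^2/2*A := by
        have e1 : 0 ≤ 1 - 2/(x+2) := by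
          rw [sub_nonneg, div_le_one (by positivity)]; linarith
        have e2 : 0 ≤ 2/(x+2) := by positivity
        nlinarith [mul_le_mul_of_nonneg_left ih e1, mul_le_mul_of_nonneg_left h2 e2]
      refine h3.trans ?_
      have : 2 * A / (x+1+2) - ((1 - 2/(x+2)) * (2*A/(x+2)) + (2/(x+2))^2/2*A)
          = 2 * A / ((x+1+2)*(x+2)^2) := by
        field_simp; ring
      have : 0 ≤ 2 * A / ((x+1+2)*(x+2)^2) := by positivity
      linarith
  obtain ⟨m, hm⟩ : ∃ m, m = 2 * R / 3 := ⟨_, rfl⟩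
  have hm1 : 1 ≤ m := by omega
  have hm2 : 2 * R ≤ 3 * m + 2 := by omega
  have hm3 : 3 * m ≤ 2 * R := by omega
  have hm2' : 2 * (R:ℝ) ≤ 3 * m + 2 := by exact_mod_cast hm2
  have hm3' : 3 * (m:ℝ) ≤ 2 * R := by exact_mod_cast hm3
  set D : ℝ := (R:ℝ) + 2 with hD
  have hD0 : 0 < D := by positivity
  have key : ∀ r : ℕ, m ≤ r → r ≤ R → h (r+1) < h r - 23/2 * A / D^2 := by
    intro r h1 h2
    have h1' : (m:ℝ) ≤ r := by exact_mod_cast h1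
    have h2' : (r:ℝ) ≤ R := by exact_mod_cast h2
    have h3 := hrec r
    have h4 := hcon r (by omega) h2
    set k : ℝ := (r:ℝ) + 2 with hk
    have hk0 : 0 < k := by positivity
    have h5 : 2 / k * (27/4*A/D) < 2 / k * q r := mul_lt_mul_of_pos_left h4 (by positivity)
    have h6 : 2 / k * (27/4*A/D) - (2/k)^2/2*A - 23/2*A/D^2
        = A * ((D - k) * (23/2 * k - 2 * D)) / (k^2 * D^2) := by
      field_simp; ring
    have h7 : 0 ≤ A * ((D - k) * (23/2 * k - 2 * D)) / (k^2 * D^2) := by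
      have : 0 ≤ D - k := by linarith
      have : 0 ≤ 23/2 * k - 2 * D := by linarith
      positivity
    linarith
  have ind : ∀ n : ℕ, m + n ≤ R → h (m+n+1) < h m - (n+1) * (23/2 * A / D^2) := by
    intro n
    induction n with
    | zero => intro hn; have := key m le_rfl hn; simpa using this
    | succ n ih =>
      intro hn
      have a := ih (by omega)
      have b := key (m+n+1) (by omega) hn
      push_cast
      rw [← add_assoc m n 1]
      linarith
  obtain ⟨n, hn⟩ : ∃ n, R = m + n := ⟨R - m, by omega⟩
  have f := ind n hn.ge
  have f0 := hh (m+n+1)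
  have f1 : h m ≤ 2 * A / ((m:ℝ)+2) := by
    obtain ⟨j, rfl⟩ : ∃ j, m = j + 1 := ⟨m - 1, by omega⟩
    exact hprim j
  have f2 : 2 * A / ((m:ℝ)+2) ≤ 3 * A / D := by
    rw [div_le_div_iff₀ (by positivity) hD0]
    nlinarith
  have hn' : (R:ℝ) = m + n := by exact_mod_cast hn
  have f3 : D / 3 * (23/2 * A / D^2) ≤ (n+1) * (23/2 * A / D^2) :=
    mul_le_mul_of_nonneg_right (by linarith) (by positivity)
  have f4 : D / 3 * (23/2 * A / D^2) = 23/6 * (A / D) := by field_simp; ring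
  have f5 : 0 ≤ A / D := by positivity
  have f6 : 3 * A / D = 3 * (A / D) := by ring
  linarith

theorem stmt5 {K : ℕ} (hK : 1 ≤ K)
    (L : EuclideanSpace ℝ (Fin K) → ℝ)
    (gradL : EuclideanSpace ℝ (Fin K) → EuclideanSpace ℝ (Fin K))
    (hgrad : ∀ x, HasGradientAt L (gradL x) x)
    (hconv : ConvexOn ℝ Set.univ L)
    (Cf : ℝ) (hCf : 0 ≤ Cf)
    (hcurv : ∀ w ∈ simplexD K, ∀ s ∈ simplexD K, ∀ γ ∈ Set.Icc (0:ℝ) 1,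
      L (w + γ • (s - w)) ≤ L w + γ * ⟪s - w, gradL w⟫ + γ ^ 2 / 2 * Cf)
    (wstar : EuclideanSpace ℝ (Fin K)) (hwstar : wstar ∈ simplexD K)
    (hmin : ∀ v ∈ simplexD K, L wstar ≤ L v)
    (δ : ℝ) (hδ : 0 ≤ δ)
    (w s : ℕ → EuclideanSpace ℝ (Fin K))
    (hw0 : w 0 ∈ simplexD K)
    (hsmem : ∀ r : ℕ, s r ∈ simplexD K)
    (hstep : ∀ r : ℕ, w (r + 1) = w r + (2 / ((r : ℝ) + 2)) • (s r - w r))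
    (happrox : ∀ r : ℕ, ⟪s r, gradL (w r)⟫ ≤
      sInf ((fun t => ⟪t, gradL (w r)⟫) '' simplexD K) + 1 / 2 * δ * (2 / ((r : ℝ) + 2)) * Cf)
    (R : ℕ) (hR : 2 ≤ R) :
    ∃ r : ℕ, 1 ≤ r ∧ r ≤ R ∧
      dualGap gradL (w r) ≤ 2 * (27 / 8) * Cf / ((R : ℝ) + 2) * (1 + δ) := by
  have hγ0 : ∀ r : ℕ, 0 ≤ 2 / ((r:ℝ)+2) := fun r => by positivity
  have hγ1 : ∀ r : ℕ, 2 / ((r:ℝ)+2) ≤ 1 := fun r => by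
    rw [div_le_one (by positivity)]; linarith [Nat.cast_nonneg (α := ℝ) r]
  have hw : ∀ r, w r ∈ simplexD K := by
    intro r
    induction r with
    | zero => exact hw0
    | succ r ih => rw [hstep]; exact fw_mem _ _ ih (hsmem r) _ (hγ0 r) (hγ1 r)
  have hgap : ∀ r, ∀ t ∈ simplexD K, ⟪w r - t, gradL (w r)⟫ ≤
      ⟪w r - s r, gradL (w r)⟫ + 1 / 2 * δ * (2 / ((r : ℝ) + 2)) * Cf := by
    intro r t ht
    have h1 := csInf_le (fw_bdd (gradL (w r))) (Set.mem_image_of_mem _ ht)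
    have h2 := happrox r
    simp only [inner_sub_left] at *
    linarith
  obtain ⟨r, h1, h2, h3⟩ := fw_scalar (fun r => L (w r) - L wstar)
    (fun r => ⟪w r - s r, gradL (w r)⟫ + 1 / 2 * δ * (2 / ((r : ℝ) + 2)) * Cf)
    (Cf * (1 + δ)) (by positivity) (fun r => sub_nonneg.2 (hmin _ (hw r)))
    (fun r => (fw_grad_ineq L _ _ _ (hgrad (w r)) hconv).trans (hgap r _ hwstar))
    (fun r => by
      have h1 := hcurv _ (hw r) _ (hsmem r) _ ⟨hγ0 r, hγ1 r⟩
      rw [← hstep, ← neg_sub (w r) (s r), inner_neg_left] at h1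
      linarith) R hR
  refine ⟨r, h1, h2, ?_⟩
  refine (csSup_le (Set.Nonempty.image _ ⟨_, hwstar⟩) ?_).trans (h3.trans (le_of_eq (by ring)))
  rintro _ ⟨t, ht, rfl⟩
  exact hgap r t ht
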